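/- (Proposition 1, constant-β bound, Eq. (72).) Under the setting of the first bound of Proposition 1 — E a real finite-dimensional inner product space; F : E → ℝ differentiable with ζ-Lipschitz gradient (ζ > 0) and F ≥ F*; a filtered probability space with processes W, G satisfying W(t+1) = W(t) − β·G(t), the conditional coherence ⟨E[G(t)|ℱ_t], ∇F(W(t))⟩ ≥ C‖∇F(W(t))‖² and conditional moment bound E[‖G(t)‖²|ℱ_t] ≤ A + (1+Γ²)‖∇F(W(t))‖² almost surely (C > 0, Γ ≥ 0, A ≥ 0), W(t) ℱ_t-measurable, all relevant integrability — assume the mixing parameter β is a deterministic constant with 0 < β ≤ 2Cε/(ζ(1 + Γ²)) for some ε ∈ (0,1). Then for every T ≥ 1: E{(1/T)·Σ_{t=0}^{T−1} ‖∇F(W(t))‖²} ≤ (E{F(W(0))} − F*)/(C(1−ε)·β·T) + (Aζ·β)/(2C(1−ε)). -/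

import Mathlib

open MeasureTheory
open scoped RealInnerProductSpace

section SmoothFunctions

variable {E : Type*} [NormedAddCommGroup E] [InnerProductSpace ℝ E] [CompleteSpace E]
  {F : E → ℝ} {ζ : ℝ}

/-- The descent lemma: a differentiable function with `ζ`-Lipschitz gradient is bounded above by
its quadratic upper model. -/
theorem le_add_inner_gradient_add_sq (hF : Differentiable ℝ F)
    (hLip : ∀ x y : E, ‖gradient F x - gradient F y‖ ≤ ζ * ‖x - y‖) (x d : E) :
    F (x + d) ≤ F x + ⟪gradient F x, d⟫ + ζ / 2 * ‖d‖ ^ 2 := by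
  set φ : ℝ → ℝ := fun s => F (x + s • d) - s * ⟪gradient F x, d⟫ - ζ / 2 * ‖d‖ ^ 2 * s ^ 2
  have hφ : ∀ s, HasDerivAt φ
      (⟪gradient F (x + s • d) - gradient F x, d⟫ - ζ * ‖d‖ ^ 2 * s) s := by
    intro s
    have hline : HasDerivAt (fun s : ℝ => x + s • d) d s := by
      simpa using ((hasDerivAt_id s).smul_const d).const_add x
    have hFs := (hF (x + s • d)).hasFDerivAt.comp_hasDerivAt s hline
    rw [← inner_gradient_left] at hFs
    refine ((hFs.sub ((hasDerivAt_id s).mul_const ⟪gradient F x, d⟫)).sub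
      ((hasDerivAt_pow 2 s).const_mul (ζ / 2 * ‖d‖ ^ 2))).congr_deriv ?_
    simp only [inner_sub_left]
    norm_num
    ring
  have hanti : AntitoneOn φ (Set.Icc 0 1) := by
    refine antitoneOn_of_deriv_nonpos (convex_Icc 0 1)
      (fun s _ => (hφ s).continuousAt.continuousWithinAt)
      (fun s _ => (hφ s).differentiableAt.differentiableWithinAt) fun s hs => ?_
    rw [interior_Icc] at hs
    rw [(hφ s).deriv, sub_nonpos]
    calc ⟪gradient F (x + s • d) - gradient F x, d⟫
        ≤ ‖gradient F (x + s • d) - gradient F x‖ * ‖d‖ := real_inner_le_norm _ _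
      _ ≤ ζ * ‖x + s • d - x‖ * ‖d‖ := by gcongr; exact hLip _ _
      _ = ζ * ‖d‖ ^ 2 * s := by
        rw [add_sub_cancel_left, norm_smul, Real.norm_of_nonneg hs.1.le]
        ring
  have h01 := hanti (Set.left_mem_Icc.2 zero_le_one) (Set.right_mem_Icc.2 zero_le_one) zero_le_one
  simp only [φ, one_smul, zero_smul, add_zero, one_mul, zero_mul, one_pow, mul_one,
    ne_eq, OfNat.ofNat_ne_zero, not_false_eq_true, zero_pow, mul_zero, sub_zero] at h01
  linarith

/-- The squared gradient norm of a smooth function is controlled by its gap to a lower bound. -/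
theorem sq_norm_gradient_le (hF : Differentiable ℝ F) (hζ : 0 < ζ)
    (hLip : ∀ x y : E, ‖gradient F x - gradient F y‖ ≤ ζ * ‖x - y‖)
    {b : ℝ} (hb : ∀ x, b ≤ F x) (x : E) :
    ‖gradient F x‖ ^ 2 ≤ 2 * ζ * (F x - b) := by
  have h := (hb _).trans (le_add_inner_gradient_add_sq hF hLip x (-(ζ⁻¹ • gradient F x)))
  rw [inner_neg_right, real_inner_smul_right, real_inner_self_eq_norm_sq, norm_neg, norm_smul,
    Real.norm_of_nonneg (inv_nonneg.2 hζ.le)] at h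
  have hq : ζ / 2 * (ζ⁻¹ * ‖gradient F x‖) ^ 2 = ζ⁻¹ * ‖gradient F x‖ ^ 2 / 2 := by
    field_simp
  have h2 : ζ⁻¹ * ‖gradient F x‖ ^ 2 ≤ 2 * (F x - b) := by linarith
  rw [inv_mul_le_iff₀ hζ] at h2
  linarith

theorem continuous_gradient_of_lipschitz
    (hLip : ∀ x y : E, ‖gradient F x - gradient F y‖ ≤ ζ * ‖x - y‖) :
    Continuous (gradient F) :=
  (LipschitzWith.of_dist_le_mul (K := ζ.toNNReal) fun x y => by
    rw [dist_eq_norm, dist_eq_norm]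
    exact (hLip x y).trans (by gcongr; exact Real.le_coe_toNNReal ζ)).continuous

end SmoothFunctions

section SecondMoments

variable {E : Type*} [NormedAddCommGroup E] [InnerProductSpace ℝ E]
  {Ω : Type*} {m m0 : MeasurableSpace Ω} {P : Measure Ω}

/-- Pull-out property for the inner product, integrated. -/
theorem integral_inner_condExp [CompleteSpace E] [IsFiniteMeasure P] (hm : m ≤ m0) {X Y : Ω → E}
    (hX : Integrable X P) (hY : StronglyMeasurable[m] Y) (hXY : Integrable (fun ω => ⟪X ω, Y ω⟫) P) :
    Integrable (fun ω => ⟪(P[X|m]) ω, Y ω⟫) P ∧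
      ∫ ω, ⟪(P[X|m]) ω, Y ω⟫ ∂P = ∫ ω, ⟪X ω, Y ω⟫ ∂P := by
  have h : P[fun ω => ⟪X ω, Y ω⟫|m] =ᵐ[P] fun ω => ⟪(P[X|m]) ω, Y ω⟫ :=
    condExp_bilin_of_stronglyMeasurable_right (innerSL ℝ) hY hXY hX
  exact ⟨integrable_condExp.congr h, (integral_congr_ae h).symm.trans (integral_condExp hm)⟩

theorem integrable_inner_of_memLp_two {X Y : Ω → E} (hX : MemLp X 2 P) (hY : MemLp Y 2 P) :
    Integrable (fun ω => ⟪X ω, Y ω⟫) P :=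
  (hX.norm.integrable_mul hY.norm).mono' (hX.1.inner hY.1)
    (.of_forall fun _ => norm_inner_le_norm _ _)

end SecondMoments

/-- One step of stochastic descent `W' = W - β G` decreases the expected loss by a multiple of the
expected squared gradient norm, up to a noise term. -/
theorem integral_descent_step
    {E : Type*} [NormedAddCommGroup E] [InnerProductSpace ℝ E] [CompleteSpace E]
    {F : E → ℝ} (hF : Differentiable ℝ F) {ζ : ℝ} (hζ : 0 < ζ)
    (hLip : ∀ x y : E, ‖gradient F x - gradient F y‖ ≤ ζ * ‖x - y‖)
    {Ω : Type*} {m m0 : MeasurableSpace Ω} (hm : m ≤ m0) {P : Measure Ω} [IsProbabilityMeasure P]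
    {W W' G : Ω → E} {β C M A : ℝ} (hβ : 0 ≤ β)
    (hW : StronglyMeasurable[m] W) (hupd : ∀ᵐ ω ∂P, W' ω = W ω - β • G ω)
    (hFW : Integrable (fun ω => F (W ω)) P) (hFW' : Integrable (fun ω => F (W' ω)) P)
    (hgrad : Integrable (fun ω => ‖gradient F (W ω)‖ ^ 2) P) (hG : MemLp G 2 P)
    (hcoh : ∀ᵐ ω ∂P, C * ‖gradient F (W ω)‖ ^ 2 ≤ ⟪(P[G|m]) ω, gradient F (W ω)⟫)
    (hmom : ∀ᵐ ω ∂P, (P[fun ω' => ‖G ω'‖ ^ 2|m]) ω ≤ A + M * ‖gradient F (W ω)‖ ^ 2) :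
    ∫ ω, F (W' ω) ∂P ≤ ∫ ω, F (W ω) ∂P - β * (C * ∫ ω, ‖gradient F (W ω)‖ ^ 2 ∂P) +
      ζ / 2 * β ^ 2 * (A + M * ∫ ω, ‖gradient F (W ω)‖ ^ 2 ∂P) := by
  have hgm : StronglyMeasurable[m] (fun ω => gradient F (W ω)) :=
    (continuous_gradient_of_lipschitz hLip).comp_stronglyMeasurable hW
  have hgL : MemLp (fun ω => gradient F (W ω)) 2 P :=
    (memLp_two_iff_integrable_sq_norm (hgm.mono hm).aestronglyMeasurable).2 hgrad
  have hG2 : Integrable (fun ω => ‖G ω‖ ^ 2) P := (memLp_two_iff_integrable_sq_norm hG.1).1 hG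
  have hin := integrable_inner_of_memLp_two hG hgL
  obtain ⟨hcint, hceq⟩ := integral_inner_condExp hm (hG.integrable one_le_two) hgm hin
  have hcoh' : C * ∫ ω, ‖gradient F (W ω)‖ ^ 2 ∂P ≤ ∫ ω, ⟪G ω, gradient F (W ω)⟫ ∂P := by
    rw [← hceq, ← integral_const_mul]
    exact integral_mono_ae (hgrad.const_mul C) hcint hcoh
  have hmom' : ∫ ω, ‖G ω‖ ^ 2 ∂P ≤ A + M * ∫ ω, ‖gradient F (W ω)‖ ^ 2 ∂P := by
    rw [← integral_condExp hm]
    refine (integral_mono_ae integrable_condExp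
      ((integrable_const A).add (hgrad.const_mul M)) hmom).trans_eq ?_
    simp [integral_add (integrable_const A) (hgrad.const_mul M), integral_const_mul]
  have hdesc : ∀ᵐ ω ∂P, F (W' ω) ≤
      F (W ω) - β * ⟪G ω, gradient F (W ω)⟫ + ζ / 2 * β ^ 2 * ‖G ω‖ ^ 2 := by
    filter_upwards [hupd] with ω hω
    have h := le_add_inner_gradient_add_sq hF hLip (W ω) (-(β • G ω))
    rw [← sub_eq_add_neg, ← hω, inner_neg_right, real_inner_smul_right, real_inner_comm, norm_neg,
      norm_smul, mul_pow, Real.norm_eq_abs, sq_abs] at h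
    linarith
  have hint := integral_mono_ae hFW'
    ((hFW.sub (hin.const_mul β)).add (hG2.const_mul (ζ / 2 * β ^ 2))) hdesc
  rw [integral_add' (hFW.sub (hin.const_mul β)) (hG2.const_mul _),
    integral_sub' hFW (hin.const_mul β), integral_const_mul, integral_const_mul] at hint
  have h1 := mul_le_mul_of_nonneg_left hcoh' hβ
  have h2 := mul_le_mul_of_nonneg_left hmom' (by positivity : 0 ≤ ζ / 2 * β ^ 2)
  linarith

/-- Proposition 1, constant-`β` bound (Eq. (72)): under the setting of the first
bound, with a deterministic constant mixing parameter `0 < β ≤ 2Cε/(ζ(1+Γ²))`,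
the expected average squared gradient norm satisfies the stated bound. -/
theorem afafed_convergence_constant_beta_bound
    {E : Type*} [NormedAddCommGroup E] [InnerProductSpace ℝ E] [FiniteDimensional ℝ E]
    (F : E → ℝ) (hF : Differentiable ℝ F) (ζ : ℝ) (hζ : 0 < ζ)
    (hLip : ∀ w1 w2 : E, ‖gradient F w1 - gradient F w2‖ ≤ ζ * ‖w1 - w2‖)
    (Fstar : ℝ) (hFstar : ∀ w : E, Fstar ≤ F w)
    {Ω : Type*} {m0 : MeasurableSpace Ω} (P : Measure Ω) [IsProbabilityMeasure P]
    (ℱ : Filtration ℕ m0)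
    (W G : ℕ → Ω → E) (β : ℝ)
    (C Γ ε A : ℝ) (hC : 0 < C) (hΓ : 0 ≤ Γ) (hA : 0 ≤ A)
    (hε : ε ∈ Set.Ioo (0 : ℝ) 1)
    (hβ0 : 0 < β) (hβ : β ≤ 2 * C * ε / (ζ * (1 + Γ ^ 2)))
    (hWmeas : ∀ t, StronglyMeasurable[ℱ t] (W t))
    (hupd : ∀ t, ∀ᵐ ω ∂P, W (t + 1) ω = W t ω - β • G t ω)
    (hintF : ∀ t, Integrable (fun ω => F (W t ω)) P)
    (hintG : ∀ t, Integrable (fun ω => β ^ 2 * ‖G t ω‖ ^ 2) P)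
    (hcoh : ∀ t, ∀ᵐ ω ∂P,
      C * ‖gradient F (W t ω)‖ ^ 2 ≤ ⟪(P[G t|ℱ t]) ω, gradient F (W t ω)⟫)
    (hmom : ∀ t, ∀ᵐ ω ∂P,
      (P[fun ω' => ‖G t ω'‖ ^ 2|ℱ t]) ω ≤ A + (1 + Γ ^ 2) * ‖gradient F (W t ω)‖ ^ 2) :
    ∀ T : ℕ, 1 ≤ T →
      ∫ ω, (1 / (T : ℝ)) * ∑ t ∈ Finset.range T, ‖gradient F (W t ω)‖ ^ 2 ∂P ≤
        ((∫ ω, F (W 0 ω) ∂P) - Fstar) / (C * (1 - ε) * β * T) +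
          (A * ζ * β) / (2 * C * (1 - ε)) := by
  intro T hT
  obtain ⟨hε0, hε1⟩ := hε
  have hgm : ∀ t, AEStronglyMeasurable (fun ω => gradient F (W t ω)) P := fun t =>
    ((continuous_gradient_of_lipschitz hLip).comp_stronglyMeasurable
      ((hWmeas t).mono (ℱ.le t))).aestronglyMeasurable
  have hgrad : ∀ t, Integrable (fun ω => ‖gradient F (W t ω)‖ ^ 2) P := fun t =>
    (((hintF t).sub (integrable_const Fstar)).const_mul (2 * ζ)).mono' ((hgm t).norm.pow 2)
      (.of_forall fun ω => by
        rw [Real.norm_of_nonneg (sq_nonneg _)]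
        exact sq_norm_gradient_le hF hζ hLip hFstar (W t ω))
  have hGL : ∀ t, MemLp (G t) 2 P := by
    intro t
    have hWs : ∀ s, AEStronglyMeasurable (W s) P := fun s =>
      ((hWmeas s).mono (ℱ.le s)).aestronglyMeasurable
    have hGm : AEStronglyMeasurable (G t) P := by
      refine (((hWs t).sub (hWs (t + 1))).const_smul β⁻¹).congr ?_
      filter_upwards [hupd t] with ω hω
      simp [hω, smul_smul, hβ0.ne']
    refine (memLp_two_iff_integrable_sq_norm hGm).2 (((hintG t).const_mul (β ^ 2)⁻¹).congr ?_)
    exact .of_forall fun ω => inv_mul_cancel_left₀ (pow_ne_zero 2 hβ0.ne') _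
  have hstep : ∀ t, ∫ ω, F (W (t + 1) ω) ∂P ≤ ∫ ω, F (W t ω) ∂P -
      β * (C * (1 - ε)) * ∫ ω, ‖gradient F (W t ω)‖ ^ 2 ∂P + ζ / 2 * β ^ 2 * A := by
    intro t
    have h := integral_descent_step hF hζ hLip (ℱ.le t) hβ0.le (hWmeas t) (hupd t) (hintF t)
      (hintF (t + 1)) (hgrad t) (hGL t) (hcoh t) (hmom t)
    have hI : 0 ≤ ∫ ω, ‖gradient F (W t ω)‖ ^ 2 ∂P := integral_nonneg fun _ => sq_nonneg _
    rw [le_div_iff₀ (by positivity)] at hβ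
    have := mul_le_mul_of_nonneg_right hβ (mul_nonneg hβ0.le hI)
    linarith
  have hsum : ∀ n : ℕ, β * (C * (1 - ε)) *
      ∑ t ∈ Finset.range n, ∫ ω, ‖gradient F (W t ω)‖ ^ 2 ∂P ≤
        ∫ ω, F (W 0 ω) ∂P - ∫ ω, F (W n ω) ∂P + n * (ζ / 2 * β ^ 2 * A) := by
    intro n
    induction n with
    | zero => simp
    | succ n ih =>
      rw [Finset.sum_range_succ, mul_add]
      push_cast
      linarith [hstep n]
  have hlow : Fstar ≤ ∫ ω, F (W T ω) ∂P := by
    simpa using integral_mono (integrable_const Fstar) (hintF T) fun ω => hFstar (W T ω)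
  have hT0 : (0 : ℝ) < T := by exact_mod_cast hT
  have hε' : 0 < 1 - ε := sub_pos.2 hε1
  rw [integral_const_mul, integral_finsetSum _ fun t _ => hgrad t]
  calc 1 / (T : ℝ) * ∑ t ∈ Finset.range T, ∫ ω, ‖gradient F (W t ω)‖ ^ 2 ∂P
      = (β * (C * (1 - ε)) * ∑ t ∈ Finset.range T, ∫ ω, ‖gradient F (W t ω)‖ ^ 2 ∂P) /
          (C * (1 - ε) * β * T) := by field_simp
    _ ≤ ((∫ ω, F (W 0 ω) ∂P) - Fstar + T * (ζ / 2 * β ^ 2 * A)) / (C * (1 - ε) * β * T) := by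
        gcongr
        linarith [hsum T]
    _ = _ := by
        field_simp
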